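/- Let π ∈ P₂(ℝⁿ×ℝᵐ) be the law of (X,Y). Suppose d₁, d₂ : ℝᵐ → ℝⁿ are Borel measurable and ν₁, ν₂ ∈ P₂(ℝⁿ) are such that both y ↦ T_{d₁(y)}ν₁ and y ↦ T_{d₂(y)}ν₂ are versions of the conditional distribution of X given Y (i.e., T_{d₁(y)}ν₁ = π_{X|Y=y} = T_{d₂(y)}ν₂ for π_Y-almost every y). Then there exists a constant h ∈ ℝⁿ such that d₁(y) = d₂(y) + h for π_Y-almost every y; that is, the translation function d is π_Y-a.s. unique up to an additive constant. -/

import Mathlib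

open MeasureTheory ProbabilityTheory
open scoped ENNReal

/-- The translation operator `T_h ν` on measures: pushforward of `ν` under `x ↦ x + h`. -/
noncomputable def translateMeasure {n : ℕ} (h : Fin n → ℝ) (ν : Measure (Fin n → ℝ)) :
    Measure (Fin n → ℝ) :=
  ν.map (fun x => x + h)

/-- `κ` is a version of the conditional distribution of `X` given `Y` (a Markov kernel
disintegrating the joint law over the law of `Y`). -/
def IsCondDistrib {Ω : Type*} [MeasurableSpace Ω] (μ : Measure Ω) {n m : ℕ}
    (X : Ω → Fin n → ℝ) (Y : Ω → Fin m → ℝ)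
    (κ : (Fin m → ℝ) → Measure (Fin n → ℝ)) : Prop :=
  (∀ B : Set (Fin n → ℝ), MeasurableSet B → Measurable fun y => κ y B) ∧
  (∀ y, IsProbabilityMeasure (κ y)) ∧
  ∀ B : Set (Fin n → ℝ), MeasurableSet B → ∀ A : Set (Fin m → ℝ), MeasurableSet A →
    μ {ω | X ω ∈ B ∧ Y ω ∈ A} = ∫⁻ y in A, κ y B ∂(μ.map Y)

/-- The mean of a translated probability measure. -/
theorem integral_id_translateMeasure {n : ℕ} (h : Fin n → ℝ) (ν : Measure (Fin n → ℝ))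
    [IsProbabilityMeasure ν] (hν : Integrable (fun x => x) ν) :
    ∫ x, x ∂(translateMeasure h ν) = (∫ x, x ∂ν) + h := by
  rw [translateMeasure, integral_map (by fun_prop) (by fun_prop),
    integral_add hν (integrable_const _)]
  simp

/-- A square-integrable vector-valued identity is integrable. -/
theorem integrable_id_of_integrable_norm_sq {n : ℕ} (ν : Measure (Fin n → ℝ))
    [IsProbabilityMeasure ν] (hν : Integrable (fun x => ‖x‖ ^ 2) ν) :
    Integrable (fun x => x) ν :=
  ((memLp_two_iff_integrable_sq_norm (by fun_prop)).2 hν).integrable (by norm_num)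

/-- A version of the conditional distribution, bundled as a kernel. -/
noncomputable def IsCondDistrib.kernel {Ω : Type*} [MeasurableSpace Ω] {μ : Measure Ω} {n m : ℕ}
    {X : Ω → Fin n → ℝ} {Y : Ω → Fin m → ℝ} {κ : (Fin m → ℝ) → Measure (Fin n → ℝ)}
    (hκ : IsCondDistrib μ X Y κ) : Kernel (Fin m → ℝ) (Fin n → ℝ) where
  toFun := κ
  measurable' := Measure.measurable_of_measurable_coe _ hκ.1

/-- Two versions of the conditional distribution agree almost everywhere. -/
theorem IsCondDistrib.ae_eq {Ω : Type*} [MeasurableSpace Ω] {μ : Measure Ω}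
    [IsProbabilityMeasure μ] {n m : ℕ} {X : Ω → Fin n → ℝ} {Y : Ω → Fin m → ℝ}
    {κ η : (Fin m → ℝ) → Measure (Fin n → ℝ)}
    (hκ : IsCondDistrib μ X Y κ) (hη : IsCondDistrib μ X Y η) :
    ∀ᵐ y ∂(μ.map Y), κ y = η y := by
  have : IsMarkovKernel hκ.kernel := ⟨hκ.2.1⟩
  have : IsMarkovKernel hη.kernel := ⟨hη.2.1⟩
  have h : (μ.map Y) ⊗ₘ hκ.kernel = (μ.map Y) ⊗ₘ hη.kernel := by
    refine Measure.ext_prod fun {A B} hA hB => ?_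
    rw [Measure.compProd_apply_prod hA hB, Measure.compProd_apply_prod hA hB]
    exact (hκ.2.2 B hB A hA).symm.trans (hη.2.2 B hB A hA)
  exact Kernel.ae_eq_of_compProd_eq h

/-- Let `π ∈ P₂(ℝⁿ×ℝᵐ)` be the law of `(X,Y)`.  If `d₁, d₂ : ℝᵐ → ℝⁿ`
are Borel measurable and `ν₁, ν₂ ∈ P₂(ℝⁿ)` are such that both `y ↦ T_{d₁(y)} ν₁` and
`y ↦ T_{d₂(y)} ν₂` are versions of the conditional distribution of `X` given `Y`, then
there is a constant `h ∈ ℝⁿ` with `d₁(y) = d₂(y) + h` for `π_Y`-a.e. `y`. -/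
theorem translation_function_unique_up_to_constant {n m : ℕ} (hn : 1 ≤ n) (hm : 1 ≤ m)
    {Ω : Type*} [MeasurableSpace Ω] (μ : Measure Ω) [IsProbabilityMeasure μ]
    (X : Ω → Fin n → ℝ) (Y : Ω → Fin m → ℝ) (hX : Measurable X) (hY : Measurable Y)
    (hX2 : Integrable (fun ω => ‖X ω‖ ^ 2) μ) (hY2 : Integrable (fun ω => ‖Y ω‖ ^ 2) μ)
    (d₁ d₂ : (Fin m → ℝ) → Fin n → ℝ) (hd₁ : Measurable d₁) (hd₂ : Measurable d₂)
    (ν₁ ν₂ : Measure (Fin n → ℝ))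
    (hν₁ : IsProbabilityMeasure ν₁) (hν₂ : IsProbabilityMeasure ν₂)
    (hν₁2 : Integrable (fun x => ‖x‖ ^ 2) ν₁) (hν₂2 : Integrable (fun x => ‖x‖ ^ 2) ν₂)
    (hker₁ : IsCondDistrib μ X Y (fun y => translateMeasure (d₁ y) ν₁))
    (hker₂ : IsCondDistrib μ X Y (fun y => translateMeasure (d₂ y) ν₂)) :
    ∃ h : Fin n → ℝ, ∀ᵐ y ∂(μ.map Y), d₁ y = d₂ y + h := by
  refine ⟨(∫ x, x ∂ν₂) - ∫ x, x ∂ν₁, ?_⟩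
  filter_upwards [hker₁.ae_eq hker₂] with y hy
  have h := congrArg (fun ρ : Measure (Fin n → ℝ) => ∫ x, x ∂ρ) hy
  simp only [integral_id_translateMeasure _ _ (integrable_id_of_integrable_norm_sq _ hν₁2),
    integral_id_translateMeasure _ _ (integrable_id_of_integrable_norm_sq _ hν₂2)] at h
  rw [add_sub_assoc', eq_sub_iff_add_eq, add_comm, h, add_comm]
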